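/- Let i, j be nonnegative integers, x a complex number, and α a complex number such that none of 2α−i, 2α−j, α+m−i+1/2 (0 ≤ m ≤ i), α+n−j+1/2 (0 ≤ n ≤ j), and 2α+m+n−i−j (0 ≤ m ≤ i, 0 ≤ n ≤ j) is a nonpositive integer, and such that (α−i−1/2)_m ≠ 0 for 0 ≤ m ≤ i and (α−j−1/2)_n ≠ 0 for 0 ≤ n ≤ j. Then ₁F₁(α; 2α−i; x) · ₁F₁(α; 2α−j; x) = e^x · Σ_{m=0}^{i} Σ_{n=0}^{j} [(−1)^{m+n} (−i)_m (−j)_n (2α−2i−1)_m (2α−2j−1)_n x^{m+n}] / [(2α−i)_m (2α−j)_n (α−i−1/2)_m (α−j−1/2)_n 2^{2m+2n} m! n!] · ₂F₃((2α+m+n−i−j+1)/2, (2α+m+n−i−j)/2; α+m−i+1/2, α+n−j+1/2, 2α+m+n−i−j; x²/4). -/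

import Mathlib

/-- Pochhammer symbol (rising factorial) `(c)_k = c (c+1) ⋯ (c+k-1)` for complex `c`. -/
noncomputable def poch (c : ℂ) (k : ℕ) : ℂ := ∏ l ∈ Finset.range k, (c + l)

/-- Generalized hypergeometric series `ₚF_q(a; b; x) = Σ_k (a₁)_k⋯(a_p)_k / ((b₁)_k⋯(b_q)_k) · x^k/k!`. -/
noncomputable def pFq (a b : List ℂ) (x : ℂ) : ℂ :=
  ∑' k : ℕ, ((a.map (fun c => poch c k)).prod / (b.map (fun c => poch c k)).prod)
    * x ^ k / (Nat.factorial k)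

/-- `c` is not a nonpositive integer, i.e. `c ≠ 0, -1, -2, …`. -/
def NotNonposInt (c : ℂ) : Prop := ∀ n : ℕ, c ≠ -(n : ℂ)

section

open Finset PowerSeries

theorem poch_zero (c : ℂ) : poch c 0 = 1 := by simp [poch]

theorem poch_succ (c : ℂ) (k : ℕ) : poch c (k + 1) = poch c k * (c + k) := by
  simp [poch, prod_range_succ]

theorem poch_succ' (c : ℂ) (k : ℕ) : poch c (k + 1) = c * poch (c + 1) k := by
  simp only [poch, prod_range_succ', Nat.cast_zero, add_zero]
  rw [mul_comm]
  congr 1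
  refine prod_congr rfl fun l _ => ?_
  push_cast
  ring

theorem poch_add (c : ℂ) (k l : ℕ) : poch c (k + l) = poch c k * poch (c + k) l := by
  simp only [poch, prod_range_add]
  congr 1
  refine prod_congr rfl fun l _ => ?_
  push_cast
  ring

theorem NotNonposInt.add_ne_zero {c : ℂ} (h : NotNonposInt c) (k : ℕ) : c + k ≠ 0 :=
  fun h0 => h k (eq_neg_of_add_eq_zero_left h0)

theorem NotNonposInt.poch_ne_zero {c : ℂ} (h : NotNonposInt c) (k : ℕ) : poch c k ≠ 0 :=
  prod_ne_zero_iff.2 fun l _ => h.add_ne_zero l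

theorem NotNonposInt.add_nat {c : ℂ} (h : NotNonposInt c) (k : ℕ) : NotNonposInt (c + k) := by
  intro n hn
  apply h (n + k)
  push_cast
  linear_combination hn

theorem poch_two_mul (c : ℂ) (k : ℕ) :
    poch c (2 * k) = 4 ^ k * poch (c / 2) k * poch ((c + 1) / 2) k := by
  induction k with
  | zero => simp [poch_zero]
  | succ k ih =>
    rw [show 2 * (k + 1) = 2 * k + 1 + 1 by ring, poch_succ, poch_succ, ih, poch_succ, poch_succ]
    push_cast
    ring

theorem descPochhammer_smeval_eq_prod (r : ℂ) (k : ℕ) :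
    (descPochhammer ℤ k).smeval r = ∏ l ∈ range k, (r - l) := by
  induction k with
  | zero => simp
  | succ k ih =>
    rw [descPochhammer_succ_right, Polynomial.smeval_mul, ih, prod_range_succ,
      Polynomial.smeval_sub, Polynomial.smeval_X, Polynomial.smeval_natCast]
    simp

theorem descPochhammer_smeval_eq_poch (r c : ℂ) (k : ℕ) (h : r = c + k - 1) :
    (descPochhammer ℤ k).smeval r = poch c k := by
  rw [descPochhammer_smeval_eq_prod, poch, ← prod_range_reflect]
  refine prod_congr rfl fun l hl => ?_
  have hl' : l + 1 ≤ k := mem_range.1 hl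
  rw [show k - 1 - l = k - (l + 1) by omega, Nat.cast_sub hl', h]
  push_cast
  ring

/-- Chu–Vandermonde in the form giving the coefficients of a product of two `₀F₁` series. -/
theorem sum_antidiagonal_inv_poch {a b : ℂ} (ha : NotNonposInt a) (hb : NotNonposInt b) (N : ℕ) :
    ∑ kl ∈ antidiagonal N, 1 / (poch a kl.1 * kl.1.factorial) *
      (1 / (poch b kl.2 * kl.2.factorial)) =
    poch (a + b - 1 + N) N / (poch a N * poch b N * N.factorial) := by
  rw [← descPochhammer_smeval_eq_poch ((b + N - 1) + (a + N - 1)) _ _ (by ring),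
    Ring.descPochhammer_smeval_add _ (Commute.all _ _), sum_div]
  refine sum_congr rfl fun ⟨k, l⟩ hkl => ?_
  obtain rfl : k + l = N := by simpa using hkl
  rw [descPochhammer_smeval_eq_poch _ (b + l) k (by push_cast; ring),
    descPochhammer_smeval_eq_poch _ (a + k) l (by push_cast; ring), poch_add a, add_comm k l,
    poch_add b, add_comm l k, ← Nat.add_choose_mul_factorial_mul_factorial k l,
    ← Nat.choose_symm_add (a := k) (b := l)]
  have h1 := ha.poch_ne_zero k
  have h2 := (ha.add_nat k).poch_ne_zero l
  have h3 := hb.poch_ne_zero l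
  have h4 := (hb.add_nat l).poch_ne_zero k
  have h5 : ((k + l).choose k : ℂ) ≠ 0 :=
    Nat.cast_ne_zero.2 (Nat.choose_pos (Nat.le_add_right k l)).ne'
  have h6 : (k.factorial : ℂ) ≠ 0 := Nat.cast_ne_zero.2 k.factorial_ne_zero
  have h7 : (l.factorial : ℂ) ≠ 0 := Nat.cast_ne_zero.2 l.factorial_ne_zero
  push_cast
  field_simp

theorem summable_zeroFOne (c z : ℂ) :
    Summable fun k : ℕ => 1 / (poch c k * k.factorial) * z ^ k := by
  refine summable_of_ratio_norm_eventually_le (r := 1 / 2) (by norm_num) ?_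
  obtain ⟨N, hN⟩ := exists_nat_ge (‖c‖ + 1 + 2 * ‖z‖)
  filter_upwards [Filter.eventually_ge_atTop N] with k hk
  have hk' : (N : ℝ) ≤ k := by exact_mod_cast hk
  have hz := norm_nonneg z
  have hc := norm_nonneg c
  have h1 : 1 ≤ ‖c + k‖ := by
    have := norm_sub_le (c + k) c
    rw [add_sub_cancel_left, Complex.norm_natCast] at this
    linarith
  have h2 : 2 * ‖z‖ ≤ ‖c + k‖ * (k + 1) := by nlinarith
  have h3 : 0 < ‖c + k‖ * (k + 1) := by positivity
  have key : 1 / (poch c (k + 1) * ((k + 1).factorial : ℂ)) * z ^ (k + 1) =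
      z / ((c + k) * (k + 1)) * (1 / (poch c k * k.factorial) * z ^ k) := by
    rw [poch_succ, Nat.factorial_succ]
    push_cast
    rw [pow_succ]
    simp only [div_eq_mul_inv, mul_inv]
    ring
  rw [key, norm_mul]
  refine mul_le_mul_of_nonneg_right ?_ (norm_nonneg _)
  have h4 : ‖(k : ℂ) + 1‖ = k + 1 := by
    exact_mod_cast Complex.norm_natCast (k + 1)
  rw [norm_div, norm_mul, h4, div_le_iff₀ h3]
  linarith

theorem zeroFOne_eq_tsum (c z : ℂ) :
    pFq [] [c] z = ∑' k : ℕ, 1 / (poch c k * k.factorial) * z ^ k := by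
  refine tsum_congr fun k => ?_
  simp only [List.map_nil, List.map_cons, List.prod_nil, List.prod_cons, mul_one, div_eq_mul_inv,
    mul_inv]
  ring

theorem zeroFOne_mul_zeroFOne {a b : ℂ} (ha : NotNonposInt a) (hb : NotNonposInt b)
    (hab : NotNonposInt (a + b - 1)) (z : ℂ) :
    pFq [] [a] z * pFq [] [b] z =
      pFq [(a + b) / 2, (a + b - 1) / 2] [a, b, a + b - 1] (4 * z) := by
  rw [zeroFOne_eq_tsum, zeroFOne_eq_tsum, tsum_mul_tsum_eq_tsum_sum_antidiagonal_of_summable_norm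
    (summable_zeroFOne a z).norm (summable_zeroFOne b z).norm]
  refine tsum_congr fun N => ?_
  have h1 : ∑ kl ∈ antidiagonal N, 1 / (poch a kl.1 * kl.1.factorial) * z ^ kl.1 *
      (1 / (poch b kl.2 * kl.2.factorial) * z ^ kl.2) =
      (∑ kl ∈ antidiagonal N, 1 / (poch a kl.1 * kl.1.factorial) *
      (1 / (poch b kl.2 * kl.2.factorial))) * z ^ N := by
    rw [sum_mul]
    refine sum_congr rfl fun kl hkl => ?_
    rw [← mem_antidiagonal.1 hkl, pow_add]
    ring
  have h2 := poch_add (a + b - 1) N N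
  rw [← two_mul, poch_two_mul, sub_add_cancel] at h2
  have h3 := hab.poch_ne_zero N
  have h4 := ha.poch_ne_zero N
  have h5 := hb.poch_ne_zero N
  have h6 : (N.factorial : ℂ) ≠ 0 := Nat.cast_ne_zero.2 N.factorial_ne_zero
  rw [h1, sum_antidiagonal_inv_poch ha hb]
  simp only [List.map_nil, List.map_cons, List.prod_nil, List.prod_cons, mul_one]
  rw [mul_pow]
  field_simp
  linear_combination -z ^ N * h2

/-- The power series `X ^ m * ₀F₁(; ν + m + 1; X ^ 2 / 16)`, a normalised modified Bessel
function `I_{ν + m}(X / 2)`. -/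
noncomputable def besselSeries (ν : ℂ) (m : ℕ) : ℂ⟦X⟧ :=
  PowerSeries.mk fun N => if m ≤ N ∧ 2 ∣ N - m then
    1 / (16 ^ ((N - m) / 2) * poch (ν + m + 1) ((N - m) / 2) * ((N - m) / 2).factorial) else 0

theorem coeff_besselSeries_add (ν : ℂ) (m k : ℕ) :
    coeff (m + 2 * k) (besselSeries ν m) = 1 / (16 ^ k * poch (ν + m + 1) k * k.factorial) := by
  simp [besselSeries]

theorem coeff_besselSeries_of_ne (ν : ℂ) {m N : ℕ} (h : ∀ k, N ≠ m + 2 * k) :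
    coeff N (besselSeries ν m) = 0 := by
  rw [besselSeries, coeff_mk, if_neg]
  rintro ⟨h1, k, hk⟩
  exact h k (by omega)

theorem hasSum_besselSeries (ν : ℂ) (m : ℕ) (x : ℂ) :
    HasSum (fun N => coeff N (besselSeries ν m) * x ^ N)
      (x ^ m * pFq [] [ν + m + 1] (x ^ 2 / 16)) := by
  have hinj : Function.Injective fun k : ℕ => m + 2 * k := fun k l h => by simpa using h
  refine (hinj.hasSum_iff ?_).1 ?_
  · intro N hN
    rw [coeff_besselSeries_of_ne, zero_mul]
    rintro k rfl
    exact hN ⟨k, rfl⟩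
  · rw [zeroFOne_eq_tsum]
    convert! (summable_zeroFOne (ν + m + 1) (x ^ 2 / 16)).hasSum.mul_left (x ^ m) using 1
    funext k
    simp only [Function.comp, coeff_besselSeries_add, pow_add, pow_mul, div_eq_mul_inv,
      mul_inv, inv_pow, mul_pow, one_mul]
    ring

/-- Coefficients of `X f'' + b f' - (X / 4) f`; the series `exp (-X / 2) * ₁F₁(b / 2 + s; b; X)`
is an eigenvector of this operator with eigenvalue `s`. -/
theorem coeff_kummer_operator (b : ℂ) (f : ℂ⟦X⟧) (N : ℕ) :
    coeff N (X * d⁄dX ℂ (d⁄dX ℂ f) + C b * d⁄dX ℂ f - C (1 / 4) * (X * f)) =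
      (N + 1) * (N + b) * coeff (N + 1) f - 1 / 4 * coeff N (X * f) := by
  cases N with
  | zero =>
    simp only [map_add, map_sub, coeff_C_mul, coeff_zero_X_mul, coeff_derivative]
    push_cast
    ring
  | succ N =>
    simp only [map_add, map_sub, coeff_C_mul, coeff_succ_X_mul, coeff_derivative]
    push_cast
    ring

theorem besselSeries_recurrence (ν : ℂ) (i m : ℕ) (hm : m ≤ i)
    (hν : ∀ k : ℕ, ν + 1 + k ≠ 0) (hν0 : i ≠ 0 → ν ≠ 0) (N : ℕ) :
    (N + 1) * (N + (2 * ν + i + 1)) * coeff (N + 1) (besselSeries ν m)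
      - 1 / 4 * coeff N (X * besselSeries ν m) =
    m * (m + 2 * ν + i) * coeff N (besselSeries ν (m - 1)) +
      (i - m) * (2 * ν + m) / (16 * (ν + m) * (ν + m + 1)) *
        coeff N (besselSeries ν (m + 1)) := by
  by_cases h : ∃ k, N + 1 = m + 2 * k
  · obtain ⟨k, hk⟩ := h
    rw [hk, coeff_besselSeries_add]
    cases k with
    | zero =>
      obtain rfl : m = N + 1 := by omega
      rw [coeff_besselSeries_of_ne ν (m := N + 1 + 1) (by omega)]
      have h1 : coeff N (X * besselSeries ν (N + 1)) = 0 := by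
        cases N with
        | zero => simp
        | succ N => rw [coeff_succ_X_mul, coeff_besselSeries_of_ne ν (by omega)]
      have h2 := coeff_besselSeries_add ν N 0
      rw [mul_zero, add_zero] at h2
      rw [h1, Nat.add_sub_cancel, h2]
      rw [pow_zero, poch_zero, poch_zero, Nat.factorial_zero]
      push_cast
      ring
    | succ k =>
      obtain rfl : N = m + 1 + 2 * k := by omega
      have h1 : coeff (m + 1 + 2 * k) (X * besselSeries ν m) =
          1 / (16 ^ k * poch (ν + m + 1) k * k.factorial) := by
        rw [show m + 1 + 2 * k = m + 2 * k + 1 by ring, coeff_succ_X_mul, coeff_besselSeries_add]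
      have hP : NotNonposInt (ν + m + 2) := fun n hn => hν (m + 1 + n) (by
        push_cast; linear_combination hn)
      have hμ1 : ν + m + 1 ≠ 0 := by convert hν m using 1; ring
      have hμk : ν + m + 1 + k ≠ 0 := by convert hν (m + k) using 1; push_cast; ring
      have h3 := hP.poch_ne_zero k
      have h4 : poch (ν + m + 1) (k + 1) = (ν + m + 1) * poch (ν + m + 2) k := by
        rw [poch_succ']; ring_nf
      have h5 : poch (ν + m + 1) k = (ν + m + 1) * poch (ν + m + 2) k / (ν + m + 1 + k) := by
        rw [← h4, poch_succ]; field_simp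
      have hk1 : (k : ℂ) + 1 ≠ 0 := Nat.cast_add_one_ne_zero k
      have hkf : (k.factorial : ℂ) ≠ 0 := Nat.cast_ne_zero.2 k.factorial_ne_zero
      rw [h1, coeff_besselSeries_add, h4, h5, Nat.factorial_succ]
      have h6 : ν + ((m + 1 : ℕ) : ℂ) + 1 = ν + m + 2 := by push_cast; ring
      rw [h6]
      rcases Nat.eq_zero_or_pos m with rfl | hm0
      · rcases eq_or_ne i 0 with rfl | hi
        · push_cast
          simp only [Nat.cast_zero, add_zero] at *
          field_simp
          ring
        · have := hν0 hi
          push_cast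
          simp only [Nat.cast_zero, add_zero] at *
          field_simp
          ring
      · obtain ⟨n, rfl⟩ : ∃ n, m = n + 1 := ⟨m - 1, by omega⟩
        have hμ : ν + n + 1 ≠ 0 := by convert hν n using 1; ring
        have h7 : coeff (n + 1 + 1 + 2 * k) (besselSeries ν n) = 1 / (16 ^ (k + 1) *
            ((ν + n + 1) * ((ν + n + 2) * poch (ν + n + 3) k / (ν + n + 2 + k))) *
              ((k + 1) * k.factorial)) := by
          rw [show n + 1 + 1 + 2 * k = n + 2 * (k + 1) by ring, coeff_besselSeries_add, poch_succ',
            show ν + n + 1 + 1 = ν + (n + 1 : ℕ) + 1 by push_cast; ring, h5, Nat.factorial_succ]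
          push_cast
          ring_nf
        rw [Nat.add_sub_cancel, h7]
        push_cast at *
        rw [show ν + (n + 1) + 2 = ν + n + 3 by ring] at *
        rw [show ν + (n + 1) + 1 = ν + n + 2 by ring] at *
        rw [show ν + (n + 1) = ν + n + 1 by ring] at *
        field_simp
        ring
  · push Not at h
    have h1 : coeff N (X * besselSeries ν m) = 0 := by
      cases N with
      | zero => simp
      | succ N =>
        rw [coeff_succ_X_mul, coeff_besselSeries_of_ne ν fun k hk => h (k + 1) (by omega)]
    have h2 : (m : ℂ) * coeff N (besselSeries ν (m - 1)) = 0 := by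
      cases m with
      | zero => simp
      | succ m =>
        rw [Nat.add_sub_cancel, coeff_besselSeries_of_ne ν fun k hk => h k (by omega), mul_zero]
    rw [coeff_besselSeries_of_ne ν h, h1,
      coeff_besselSeries_of_ne ν (m := m + 1) fun k hk => h (k + 1) (by omega)]
    linear_combination -(m + 2 * ν + i) * h2

/-- Coefficients of the expansion of `exp (-X / 2) * ₁F₁(ν + i + 1 / 2; 2 * ν + i + 1; X)` in the
series `besselSeries ν m`. -/
noncomputable def besselCoeff (ν : ℂ) (i m : ℕ) : ℂ :=
  (-1) ^ m * poch (-(i : ℂ)) m * poch (2 * ν) m /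
    (poch (2 * ν + i + 1) m * poch ν m * 4 ^ m * m.factorial)

theorem besselCoeff_succ (ν : ℂ) (i m : ℕ) :
    besselCoeff ν i (m + 1) = besselCoeff ν i m *
      ((i - m) * (2 * ν + m) / ((2 * ν + i + 1 + m) * (ν + m) * 4 * (m + 1))) := by
  simp only [besselCoeff, poch_succ, Nat.factorial_succ, pow_succ, Nat.cast_mul, Nat.cast_succ,
    div_eq_mul_inv, mul_inv]
  ring

/-- The Bessel expansion of `exp (-X / 2) * ₁F₁(ν + i + 1 / 2; 2 * ν + i + 1; X)`. -/
noncomputable def besselSum (ν : ℂ) (i : ℕ) : ℂ⟦X⟧ :=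
  ∑ m ∈ range (i + 1), C (besselCoeff ν i m) * besselSeries ν m

theorem besselSum_ode (ν : ℂ) (i : ℕ) (hν : ∀ k : ℕ, ν + 1 + k ≠ 0) (hν0 : i ≠ 0 → ν ≠ 0)
    (hb : NotNonposInt (2 * ν + i + 1)) :
    X * d⁄dX ℂ (d⁄dX ℂ (besselSum ν i)) + C (2 * ν + i + 1) * d⁄dX ℂ (besselSum ν i)
      - C (1 / 4) * (X * besselSum ν i) = C (i / 2 : ℂ) * besselSum ν i := by
  have hνm : ∀ m : ℕ, i ≠ 0 → ν + m ≠ 0 := by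
    intro m hi
    cases m with
    | zero => simpa using hν0 hi
    | succ m => convert hν m using 1; push_cast; ring
  ext N
  rw [coeff_kummer_operator]
  have hsum : ∀ n, coeff n (besselSum ν i) =
      ∑ m ∈ range (i + 1), besselCoeff ν i m * coeff n (besselSeries ν m) := by
    intro n
    simp [besselSum, map_sum]
  have hsumX : coeff N (X * besselSum ν i) =
      ∑ m ∈ range (i + 1), besselCoeff ν i m * coeff N (X * besselSeries ν m) := by
    rw [besselSum, mul_sum, map_sum]
    refine sum_congr rfl fun m _ => ?_
    rw [mul_left_comm, coeff_C_mul]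
  have hlower : ∑ m ∈ range (i + 1), besselCoeff ν i m *
      (m * (m + 2 * ν + i) * coeff N (besselSeries ν (m - 1))) =
      ∑ m ∈ range (i + 1), besselCoeff ν i m *
        ((i - m) * (2 * ν + m) / (4 * (ν + m))) * coeff N (besselSeries ν m) := by
    rw [sum_range_succ', sum_range_succ]
    simp only [Nat.cast_zero, zero_mul, mul_zero, add_zero, sub_self, zero_div]
    refine sum_congr rfl fun m hm => ?_
    have h1 := hνm m (by have := mem_range.1 hm; omega)
    have h2 := hb.add_ne_zero m
    have h3 : (m : ℂ) + 1 ≠ 0 := Nat.cast_add_one_ne_zero m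
    rw [besselCoeff_succ, Nat.add_sub_cancel]
    push_cast
    field_simp
    ring
  have hupper : ∑ m ∈ range (i + 1), besselCoeff ν i m *
      ((i - m) * (2 * ν + m) / (16 * (ν + m) * (ν + m + 1)) *
        coeff N (besselSeries ν (m + 1))) =
      ∑ m ∈ range (i + 1), besselCoeff ν i m *
        (m * (2 * ν + i + m) / (4 * (ν + m))) * coeff N (besselSeries ν m) := by
    rw [sum_range_succ, sum_range_succ']
    simp only [Nat.cast_zero, zero_mul, mul_zero, add_zero, sub_self, zero_div]
    refine sum_congr rfl fun m hm => ?_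
    have h1 := hνm m (by have := mem_range.1 hm; omega)
    have h2 := hb.add_ne_zero m
    have h3 : (m : ℂ) + 1 ≠ 0 := Nat.cast_add_one_ne_zero m
    have h4 : ν + m + 1 ≠ 0 := by convert hν m using 1; ring
    have h5 : 2 * ν + i + (m + 1) ≠ 0 := by convert h2 using 1; ring
    rw [besselCoeff_succ]
    push_cast
    rw [← add_assoc ν, show 2 * ν + i + 1 + m = 2 * ν + i + (m + 1) by ring]
    field_simp
    ring
  rw [hsum, hsumX, coeff_C_mul, hsum, mul_sum, mul_sum, mul_sum, ← sum_sub_distrib]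
  calc
    _ = ∑ m ∈ range (i + 1), (besselCoeff ν i m *
          (m * (m + 2 * ν + i) * coeff N (besselSeries ν (m - 1))) + besselCoeff ν i m *
          ((i - m) * (2 * ν + m) / (16 * (ν + m) * (ν + m + 1)) *
            coeff N (besselSeries ν (m + 1)))) := by
      refine sum_congr rfl fun m hm => ?_
      have hm' : m ≤ i := Nat.lt_succ_iff.1 (mem_range.1 hm)
      linear_combination besselCoeff ν i m * besselSeries_recurrence ν i m hm' hν hν0 N
    _ = _ := by
      rw [sum_add_distrib, hlower, hupper, ← sum_add_distrib]
      refine sum_congr rfl fun m hm => ?_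
      rcases eq_or_ne i 0 with rfl | hi
      · obtain rfl : m = 0 := by simpa using hm
        simp
      · have h1 := hνm m hi
        field_simp
        ring

theorem coeff_eq_of_kummer_ode {a b : ℂ} (hb : NotNonposInt b) {f : ℂ⟦X⟧}
    (hf : X * d⁄dX ℂ (d⁄dX ℂ f) + C b * d⁄dX ℂ f - X * d⁄dX ℂ f - C a * f = 0)
    (h0 : coeff 0 f = 1) (n : ℕ) : coeff n f = poch a n / (poch b n * n.factorial) := by
  induction n with
  | zero => simp [h0, poch_zero]
  | succ n ih =>
    have h := congrArg (coeff n) hf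
    have h1 : (n + 1) * (b + n) * coeff (n + 1) f = (a + n) * coeff n f := by
      cases n with
      | zero =>
        simp only [map_add, map_sub, coeff_C_mul, coeff_zero_X_mul, coeff_derivative,
          map_zero] at h
        push_cast at h ⊢
        linear_combination h
      | succ n =>
        simp only [map_add, map_sub, coeff_C_mul, coeff_succ_X_mul, coeff_derivative,
          map_zero] at h
        push_cast at h ⊢
        linear_combination h
    have h2 : (n : ℂ) + 1 ≠ 0 := Nat.cast_add_one_ne_zero n
    have h3 := hb.add_ne_zero n
    have h4 := hb.poch_ne_zero n
    have h5 : (n.factorial : ℂ) ≠ 0 := Nat.cast_ne_zero.2 n.factorial_ne_zero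
    rw [ih] at h1
    rw [poch_succ, poch_succ, Nat.factorial_succ]
    push_cast
    field_simp at h1 ⊢
    linear_combination h1

theorem derivative_rescale_half_exp :
    d⁄dX ℂ (rescale (1 / 2 : ℂ) (exp ℂ)) = C (1 / 2) * rescale (1 / 2 : ℂ) (exp ℂ) := by
  ext n
  have h2 : (n : ℂ) + 1 ≠ 0 := Nat.cast_add_one_ne_zero n
  have h5 : (n.factorial : ℂ) ≠ 0 := Nat.cast_ne_zero.2 n.factorial_ne_zero
  simp only [coeff_derivative, coeff_rescale, coeff_exp, coeff_C_mul, Nat.factorial_succ, map_div₀,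
    map_one, map_natCast, pow_succ]
  push_cast
  field_simp

theorem kummer_ode_rescale_exp_mul {b s : ℂ} {f : ℂ⟦X⟧}
    (hf : X * d⁄dX ℂ (d⁄dX ℂ f) + C b * d⁄dX ℂ f - C (1 / 4) * (X * f) = C s * f) :
    let g := rescale (1 / 2 : ℂ) (exp ℂ) * f
    X * d⁄dX ℂ (d⁄dX ℂ g) + C b * d⁄dX ℂ g - X * d⁄dX ℂ g - C (b / 2 + s) * g = 0 := by
  intro g
  have h1 : d⁄dX ℂ g = rescale (1 / 2 : ℂ) (exp ℂ) * (C (1 / 2) * f + d⁄dX ℂ f) := by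
    simp only [g, Derivation.leibniz, smul_eq_mul, derivative_rescale_half_exp]
    ring
  have h2 : d⁄dX ℂ (d⁄dX ℂ g) =
      rescale (1 / 2 : ℂ) (exp ℂ) * (C (1 / 4) * f + d⁄dX ℂ f + d⁄dX ℂ (d⁄dX ℂ f)) := by
    rw [h1]
    simp only [Derivation.leibniz, smul_eq_mul, derivative_rescale_half_exp, map_add,
      derivative_C]
    have h3 : (C (1 / 4) : ℂ⟦X⟧) = C (1 / 2) * C (1 / 2) := by rw [← map_mul]; norm_num
    have h4 : (1 : ℂ⟦X⟧) = C (1 / 2) + C (1 / 2) := by rw [← map_add]; norm_num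
    rw [h3]
    linear_combination -(rescale (1 / 2 : ℂ) (exp ℂ) * d⁄dX ℂ f) * h4
  have h3 : (C (1 / 2) : ℂ⟦X⟧) = C (1 / 4) + C (1 / 4) := by rw [← map_add]; norm_num
  have h4 : (1 : ℂ⟦X⟧) = C (1 / 2) + C (1 / 2) := by rw [← map_add]; norm_num
  have h5 : (C (b / 2 + s) : ℂ⟦X⟧) = C b * C (1 / 2) + C s := by
    rw [← map_mul, ← map_add]; ring_nf
  rw [h2, h1, h5]
  simp only [g]
  linear_combination (rescale (1 / 2 : ℂ) (exp ℂ)) * hf - rescale (1 / 2 : ℂ) (exp ℂ) * X * f * h3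

theorem oneFOne_eq_exp_mul_sum (ν : ℂ) (i : ℕ) (hν : ∀ k : ℕ, ν + 1 + k ≠ 0)
    (hν0 : i ≠ 0 → ν ≠ 0) (hb : NotNonposInt (2 * ν + i + 1)) (x : ℂ) :
    pFq [ν + i + 1 / 2] [2 * ν + i + 1] x = Complex.exp (x / 2) *
      ∑ m ∈ range (i + 1), besselCoeff ν i m * (x ^ m * pFq [] [ν + m + 1] (x ^ 2 / 16)) := by
  have hE : HasSum (fun n => coeff n (rescale (1 / 2 : ℂ) (exp ℂ)) * x ^ n)
      (Complex.exp (x / 2)) := by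
    rw [Complex.exp_eq_exp_ℂ]
    convert! NormedSpace.expSeries_div_hasSum_exp (x / 2) using 1
    funext n
    simp only [coeff_rescale, coeff_exp, map_div₀, map_one, map_natCast, div_pow]
    ring
  have hG : HasSum (fun n => coeff n (besselSum ν i) * x ^ n)
      (∑ m ∈ range (i + 1), besselCoeff ν i m * (x ^ m * pFq [] [ν + m + 1] (x ^ 2 / 16))) := by
    convert! hasSum_sum fun m (_ : m ∈ range (i + 1)) =>
      (hasSum_besselSeries ν m x).mul_left (besselCoeff ν i m) using 1
    funext n
    simp only [besselSum, map_sum, coeff_C_mul, sum_mul, mul_assoc]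
  rw [← hE.tsum_eq, ← hG.tsum_eq, tsum_mul_tsum_eq_tsum_sum_antidiagonal_of_summable_norm
    hE.summable.norm hG.summable.norm]
  have hode := kummer_ode_rescale_exp_mul (besselSum_ode ν i hν hν0 hb)
  have h00 : coeff 0 (besselSum ν i) = 1 := by
    rw [besselSum, map_sum, sum_range_succ', sum_eq_zero, coeff_C_mul]
    · have := coeff_besselSeries_add ν 0 0
      simp only [mul_zero, add_zero] at this
      rw [this]
      simp [besselCoeff, poch_zero]
    · intro m _
      rw [coeff_C_mul, coeff_besselSeries_of_ne ν (by omega), mul_zero]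
  refine tsum_congr fun n => ?_
  have hn := coeff_eq_of_kummer_ode hb hode
    (by rw [coeff_mul, Finset.Nat.antidiagonal_zero, sum_singleton, h00]; simp) n
  have ha : (2 * ν + i + 1) / 2 + i / 2 = ν + i + 1 / 2 := by ring
  rw [ha, coeff_mul] at hn
  have hl : ∑ kl ∈ antidiagonal n, coeff kl.1 (rescale (1 / 2 : ℂ) (exp ℂ)) * x ^ kl.1 *
      (coeff kl.2 (besselSum ν i) * x ^ kl.2) = (∑ kl ∈ antidiagonal n,
        coeff kl.1 (rescale (1 / 2 : ℂ) (exp ℂ)) * coeff kl.2 (besselSum ν i)) * x ^ n := by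
    rw [sum_mul]
    refine sum_congr rfl fun kl hkl => ?_
    rw [← mem_antidiagonal.1 hkl, pow_add]
    ring
  rw [hl, hn]
  simp only [List.map_nil, List.map_cons, List.prod_nil, List.prod_cons, mul_one, div_eq_mul_inv,
    mul_inv]
  ring

end

theorem bailey_special_3_2 (i j : ℕ) (x α : ℂ)
    (h1 : NotNonposInt (2*α - i)) (h2 : NotNonposInt (2*α - j))
    (h3 : ∀ m : ℕ, m ≤ i → NotNonposInt (α + m - i + 1/2))
    (h4 : ∀ n : ℕ, n ≤ j → NotNonposInt (α + n - j + 1/2))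
    (h5 : ∀ m n : ℕ, m ≤ i → n ≤ j → NotNonposInt (2*α + m + n - i - j))
    (h6 : ∀ m : ℕ, m ≤ i → poch (α - i - 1/2) m ≠ 0)
    (h7 : ∀ n : ℕ, n ≤ j → poch (α - j - 1/2) n ≠ 0) :
    pFq [α] [2*α - i] x * pFq [α] [2*α - j] x =
      Complex.exp x *
        ∑ m ∈ Finset.range (i+1), ∑ n ∈ Finset.range (j+1),
          ((-1) ^ (m+n) * poch (-(i:ℂ)) m * poch (-(j:ℂ)) n
              * poch (2*α - 2*i - 1) m * poch (2*α - 2*j - 1) n * x ^ (m+n)) /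
            (poch (2*α - i) m * poch (2*α - j) n * poch (α - i - 1/2) m * poch (α - j - 1/2) n
              * 2 ^ (2*m + 2*n) * (Nat.factorial m) * (Nat.factorial n)) *
          pFq [(2*α+m+n-i-j+1)/2, (2*α+m+n-i-j)/2]
              [α+m-i+1/2, α+n-j+1/2, 2*α+m+n-i-j] (x^2/4) := by
  have key : ∀ i : ℕ, NotNonposInt (2 * α - i) →
      (∀ m : ℕ, m ≤ i → NotNonposInt (α + m - i + 1/2)) →
      (∀ m : ℕ, m ≤ i → poch (α - i - 1/2) m ≠ 0) →
      pFq [α] [2 * α - i] x = Complex.exp (x / 2) * ∑ m ∈ Finset.range (i + 1),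
        besselCoeff (α - i - 1/2) i m * (x ^ m * pFq [] [α + m - i + 1/2] (x ^ 2 / 16)) := by
    intro i hb hc hp
    have h := oneFOne_eq_exp_mul_sum (α - i - 1/2) i ?_ ?_ ?_ x
    · rw [show α - i - 1/2 + i + 1/2 = α by ring,
        show 2 * (α - i - 1/2) + i + 1 = 2 * α - i by ring] at h
      rw [h]
      congr 1
      refine Finset.sum_congr rfl fun m _ => ?_
      rw [show α - i - 1/2 + m + 1 = α + m - i + 1/2 by ring]
    · intro k
      convert (hc 0 (Nat.zero_le i)).add_ne_zero k using 1
      push_cast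
      ring
    · intro hi h0
      apply hp 1 (Nat.one_le_iff_ne_zero.2 hi)
      rw [poch, Finset.prod_range_one, h0, Nat.cast_zero, add_zero]
    · convert hb using 1
      ring
  rw [key i h1 h3 h6, key j h2 h4 h7, mul_mul_mul_comm, ← Complex.exp_add, add_halves,
    Finset.sum_mul_sum]
  congr 1
  refine Finset.sum_congr rfl fun m hm => Finset.sum_congr rfl fun n hn => ?_
  have hm' : m ≤ i := Nat.lt_succ_iff.1 (Finset.mem_range.1 hm)
  have hn' : n ≤ j := Nat.lt_succ_iff.1 (Finset.mem_range.1 hn)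
  have hs : (α + m - i + 1/2) + (α + n - j + 1/2) - 1 = 2*α + m + n - i - j := by ring
  have hprod := zeroFOne_mul_zeroFOne (h3 m hm') (h4 n hn')
    (by rw [hs]; exact h5 m n hm' hn') (x ^ 2 / 16)
  rw [hs, show (α + m - i + 1/2) + (α + n - j + 1/2) = 2*α + m + n - i - j + 1 by ring,
    show 4 * (x ^ 2 / 16) = x ^ 2 / 4 by ring] at hprod
  rw [← hprod, besselCoeff, besselCoeff, show 2 * (α - i - 1/2) + i + 1 = 2 * α - i by ring,
    show 2 * (α - j - 1/2) + j + 1 = 2 * α - j by ring,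
    show 2 * (α - i - 1/2) = 2 * α - 2 * i - 1 by ring,
    show 2 * (α - j - 1/2) = 2 * α - 2 * j - 1 by ring, pow_add 2, pow_mul 2, pow_mul 2,
    show (2 : ℂ) ^ 2 = 4 by norm_num]
  simp only [div_eq_mul_inv, mul_inv, pow_add]
  ring
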